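/- Let n ≥ 1, let M : ℝⁿ → Matₙ(ℝ) be a smooth matrix-valued function of the velocity with M(v) symmetric for every v, and let A : ℝ × ℝⁿ → Matₙ(ℝ) and φ : ℝ × ℝⁿ → ℝⁿ be smooth. Assume that for all indices i, j, k and all arguments: (i) Σ_{k=1}^n (∂M_{ik}/∂v_j)(v) v_k = Σ_{k=1}^n (∂M_{jk}/∂v_i)(v) v_k; (ii) A(t,x)ᵀ = −A(t,x); (iii) ∂A_{jk}/∂x_i + ∂A_{ki}/∂x_j + ∂A_{ij}/∂x_k = 0; (iv) ∂φ_i/∂x_j − ∂φ_j/∂x_i = ∂A_{ij}/∂t. Then there exists a smooth function L : ℝ × ℝⁿ × ℝⁿ → ℝ such that for every smooth curve x : ℝ → ℝⁿ and every t, (d/dt)[(∂L/∂v)(t, x(t), ẋ(t))] − (∂L/∂x)(t, x(t), ẋ(t)) = (d/dt)[M(ẋ(t)) ẋ(t)] − A(t, x(t)) ẋ(t) − φ(t, x(t)). -/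

import Mathlib

section ParametricIntegral

universe u

variable {E F : Type u} [NormedAddCommGroup E] [NormedSpace ℝ E]
  [NormedAddCommGroup F] [NormedSpace ℝ F]

theorem contDiff_uncurry_fderiv_left {f : E → ℝ → F}
    (hf : ContDiff ℝ (⊤ : ℕ∞) (Function.uncurry f)) :
    ContDiff ℝ (⊤ : ℕ∞) (Function.uncurry fun q s => fderiv ℝ (fun r => f r s) q) := by
  have h : ContDiff ℝ (⊤ : ℕ∞) (Function.uncurry fun (z : E × ℝ) (q : E) => f q z.2) :=
    hf.comp (contDiff_snd.prodMk (contDiff_snd.comp contDiff_fst))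
  exact h.fderiv (m := (⊤ : ℕ∞)) contDiff_fst (by simp)

variable [ProperSpace E]

theorem hasFDerivAt_intervalIntegral_of_contDiff {f : E → ℝ → F}
    (hf : ContDiff ℝ (⊤ : ℕ∞) (Function.uncurry f)) (a b : ℝ) (p : E) :
    HasFDerivAt (fun q => ∫ s in a..b, f q s)
      (∫ s in a..b, fderiv ℝ (fun q => f q s) p) p := by
  have hcont := (contDiff_uncurry_fderiv_left hf).continuous
  have hslice (q : E) : Continuous (f q) :=
    hf.continuous.comp (Continuous.prodMk_right q)
  obtain ⟨C, hC⟩ := ((isCompact_closedBall p 1).prod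
    (isCompact_uIcc (a := a) (b := b))).exists_bound_of_continuousOn hcont.continuousOn
  refine intervalIntegral.hasFDerivAt_integral_of_dominated_of_fderiv_le
    (F' := fun q s => fderiv ℝ (fun q => f q s) q) (bound := fun _ => C)
    (Metric.closedBall_mem_nhds p one_pos) ?_ ((hslice p).intervalIntegrable _ _) ?_ ?_
    intervalIntegrable_const ?_
  · exact .of_forall fun q => (hslice q).aestronglyMeasurable
  · exact (hcont.comp (Continuous.prodMk_right p)).aestronglyMeasurable
  · exact .of_forall fun s hs q hq => hC (q, s) ⟨hq, Set.uIoc_subset_uIcc hs⟩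
  · refine .of_forall fun s _ q _ => DifferentiableAt.hasFDerivAt ?_
    exact ((hf.comp (contDiff_prodMk_left s)).differentiable (by simp)) q

theorem fderiv_intervalIntegral_apply_of_contDiff {f : E → ℝ → F}
    (hf : ContDiff ℝ (⊤ : ℕ∞) (Function.uncurry f)) (a b : ℝ) (p w : E) :
    fderiv ℝ (fun q => ∫ s in a..b, f q s) p w =
      ∫ s in a..b, fderiv ℝ (fun q => f q s) p w := by
  rw [(hasFDerivAt_intervalIntegral_of_contDiff hf a b p).fderiv,
    ContinuousLinearMap.intervalIntegral_apply]
  exact ((contDiff_uncurry_fderiv_left hf).continuous.comp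
    (Continuous.prodMk_right p)).intervalIntegrable _ _

theorem contDiff_intervalIntegral_of_contDiff {f : E → ℝ → F}
    (hf : ContDiff ℝ (⊤ : ℕ∞) (Function.uncurry f)) (a b : ℝ) :
    ContDiff ℝ (⊤ : ℕ∞) (fun q => ∫ s in a..b, f q s) := by
  refine contDiff_infty.2 fun m => ?_
  induction m generalizing F with
  | zero =>
    exact contDiff_zero.2 (Differentiable.continuous fun p =>
      (hasFDerivAt_intervalIntegral_of_contDiff hf a b p).differentiableAt)
  | succ m ih =>
    have hd := hasFDerivAt_intervalIntegral_of_contDiff hf a b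
    rw [Nat.cast_succ, contDiff_succ_iff_fderiv]
    refine ⟨fun p => (hd p).differentiableAt, by simp, ?_⟩
    rw [funext fun p => (hd p).fderiv]
    exact ih (contDiff_uncurry_fderiv_left hf)

end ParametricIntegral

theorem ContinuousLinearMap.apply_eq_sum_single {n : ℕ} (f : (Fin n → ℝ) →L[ℝ] ℝ)
    (x : Fin n → ℝ) : f x = ∑ j, x j * f (Pi.single j 1) := by
  conv_lhs => rw [pi_eq_sum_univ' x]
  simp [map_sum]

/-- A smooth vector field on `ℝⁿ` with symmetric Jacobian is the gradient of a smooth function. -/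
theorem exists_contDiff_gradient_eq {n : ℕ} {p : (Fin n → ℝ) → Fin n → ℝ}
    (hp : ∀ i, ContDiff ℝ (⊤ : ℕ∞) fun v => p v i)
    (hsymm : ∀ v i j, fderiv ℝ (fun w => p w i) v (Pi.single j 1) =
      fderiv ℝ (fun w => p w j) v (Pi.single i 1)) :
    ∃ K : (Fin n → ℝ) → ℝ, ContDiff ℝ (⊤ : ℕ∞) K ∧
      ∀ v i, fderiv ℝ K v (Pi.single i 1) = p v i := by
  let ω : (Fin n → ℝ) → (Fin n → ℝ) →L[ℝ] ℝ := fun v =>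
    ∑ i, p v i • ContinuousLinearMap.proj (R := ℝ) (φ := fun _ : Fin n => ℝ) i
  have hω : ContDiff ℝ (⊤ : ℕ∞) ω := ContDiff.sum fun i _ => (hp i).smul contDiff_const
  have hdω (v x y : Fin n → ℝ) :
      fderiv ℝ ω v x y = ∑ i, fderiv ℝ (fun w => p w i) v x * y i := by
    have h : HasFDerivAt ω _ v := HasFDerivAt.fun_sum fun i _ =>
      (((hp i).differentiable (by simp)) v).hasFDerivAt.smul_const
        (ContinuousLinearMap.proj (R := ℝ) (φ := fun _ : Fin n => ℝ) i)
    simp [h.fderiv]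
  obtain ⟨K, hK⟩ := convex_univ.exists_forall_hasFDerivAt_of_fderiv_symmetric isOpen_univ
    (hω.differentiable (by simp)).differentiableOn (ω := ω) fun v _ x y => by
      rw [hdω, hdω, Finset.sum_congr rfl fun i _ => congrArg (· * y i)
          ((fderiv ℝ (fun w => p w i) v).apply_eq_sum_single x),
        Finset.sum_congr rfl fun i _ => congrArg (· * x i)
          ((fderiv ℝ (fun w => p w i) v).apply_eq_sum_single y)]
      simp only [Finset.sum_mul]
      rw [Finset.sum_comm]
      refine Finset.sum_congr rfl fun i _ => Finset.sum_congr rfl fun j _ => ?_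
      rw [hsymm v j i]
      ring
  have hK' (v : Fin n → ℝ) : HasFDerivAt K (ω v) v := hK v (Set.mem_univ v)
  refine ⟨K, ?_, fun v i => ?_⟩
  · rw [contDiff_infty_iff_fderiv, funext fun v => (hK' v).fderiv]
    exact ⟨fun v => (hK' v).differentiableAt, hω⟩
  · simp [(hK' v).fderiv, ω, Pi.single_apply]

/-- Poincaré lemma for smooth closed `2`-forms on `ℝⁿ`, in coordinates. -/
theorem exists_contDiff_curl_eq {n : ℕ} {B : (Fin n → ℝ) → Matrix (Fin n) (Fin n) ℝ}
    (hB : ∀ i k, ContDiff ℝ (⊤ : ℕ∞) fun q => B q i k)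
    (hskew : ∀ q, (B q).transpose = -B q)
    (hclosed : ∀ q i j k,
      fderiv ℝ (fun y => B y j k) q (Pi.single i 1)
        + fderiv ℝ (fun y => B y k i) q (Pi.single j 1)
        + fderiv ℝ (fun y => B y i j) q (Pi.single k 1) = 0) :
    ∃ a : (Fin n → ℝ) → Fin n → ℝ, (∀ i, ContDiff ℝ (⊤ : ℕ∞) fun q => a q i) ∧
      ∀ q i j, fderiv ℝ (fun y => a y j) q (Pi.single i 1) -
        fderiv ℝ (fun y => a y i) q (Pi.single j 1) = B q i j := by
  have hskew' (q : Fin n → ℝ) (i j : Fin n) : B q j i = -B q i j :=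
    congrFun (congrFun (hskew q) i) j
  have hBd (i k : Fin n) : Differentiable ℝ fun q => B q i k := (hB i k).differentiable (by simp)
  have hBd' (i k : Fin n) : Continuous fun q => fderiv ℝ (fun y => B y i k) q :=
    (hB i k).continuous_fderiv (by simp)
  have hint (j : Fin n) : ContDiff ℝ (⊤ : ℕ∞)
      (Function.uncurry fun (q : Fin n → ℝ) (s : ℝ) => s * ∑ l, q l * B (s • q) l j) := by
    refine contDiff_snd.mul (ContDiff.sum fun l _ => ?_)
    exact ((contDiff_apply ℝ ℝ l).comp contDiff_fst).mul
      ((hB l j).comp (contDiff_snd.smul contDiff_fst))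
  have hd (j : Fin n) (q : Fin n → ℝ) (s : ℝ) (i : Fin n) :
      fderiv ℝ (fun r : Fin n → ℝ => s * ∑ l, r l * B (s • r) l j) q (Pi.single i 1) =
        s * B (s • q) i j +
          s ^ 2 * ∑ l, q l * fderiv ℝ (fun y => B y l j) (s • q) (Pi.single i 1) := by
    have h : HasFDerivAt (fun r : Fin n → ℝ => s * ∑ l, r l * B (s • r) l j) _ q :=
      (HasFDerivAt.fun_sum fun l _ => (hasFDerivAt_apply l q).mul
        ((hBd l j (s • q)).hasFDerivAt.comp q ((hasFDerivAt_id q).const_smul s))).const_mul s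
    rw [h.fderiv]
    simp [Pi.single_apply, Finset.sum_add_distrib, Finset.mul_sum]
    rw [add_comm]
    congr 1
    refine Finset.sum_congr rfl fun l _ => ?_
    ring
  refine ⟨fun q j => ∫ s in (0 : ℝ)..1, s * ∑ l, q l * B (s • q) l j,
    fun j => contDiff_intervalIntegral_of_contDiff (hint j) 0 1, fun q i j => ?_⟩
  rw [fderiv_intervalIntegral_apply_of_contDiff (hint j),
    fderiv_intervalIntegral_apply_of_contDiff (hint i)]
  simp only [hd]
  rw [← intervalIntegral.integral_sub]
  rotate_left
  · refine Continuous.intervalIntegrable ?_ _ _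
    have := (hB i j).continuous
    fun_prop
  · refine Continuous.intervalIntegrable ?_ _ _
    have := (hB j i).continuous
    fun_prop
  have hprim (s : ℝ) : HasDerivAt (fun s : ℝ => s ^ 2 * B (s • q) i j)
      ((s * B (s • q) i j +
          s ^ 2 * ∑ l, q l * fderiv ℝ (fun y => B y l j) (s • q) (Pi.single i 1)) -
        (s * B (s • q) j i +
          s ^ 2 * ∑ l, q l * fderiv ℝ (fun y => B y l i) (s • q) (Pi.single j 1))) s := by
    have h := (hasDerivAt_pow 2 s).mul ((hBd i j (s • q)).hasFDerivAt.comp_hasDerivAt s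
      ((hasDerivAt_id s).smul_const q))
    refine h.congr_deriv ?_
    have hfd (k l m : Fin n) : fderiv ℝ (fun y => B y k l) (s • q) (Pi.single m 1) =
        -fderiv ℝ (fun y => B y l k) (s • q) (Pi.single m 1) := by
      rw [show (fun y => B y k l) = fun y => -B y l k from funext fun y => hskew' y l k]
      simp
    rw [one_smul, (fderiv ℝ (fun y => B y i j) (s • q)).apply_eq_sum_single q, hskew' _ i j]
    have hsum : ∑ l, q l * fderiv ℝ (fun y => B y i j) (s • q) (Pi.single l 1) =
        ∑ l, q l * fderiv ℝ (fun y => B y l j) (s • q) (Pi.single i 1) -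
        ∑ l, q l * fderiv ℝ (fun y => B y l i) (s • q) (Pi.single j 1) := by
      rw [← Finset.sum_sub_distrib]
      refine Finset.sum_congr rfl fun l _ => ?_
      linear_combination q l * (hclosed (s • q) l i j - hfd j l i)
    rw [hsum]
    simp
    ring
  rw [intervalIntegral.integral_eq_sub_of_hasDerivAt fun s _ => hprim s]
  · simp
  · refine Continuous.intervalIntegrable ?_ _ _
    have := (hB j i).continuous
    have := (hB i j).continuous
    fun_prop

/-- Smooth vector potential in temporal gauge for the electromagnetic-type field `(A, φ)`. -/
theorem exists_contDiff_temporal_gauge_potential {n : ℕ}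
    {A : ℝ → (Fin n → ℝ) → Matrix (Fin n) (Fin n) ℝ}
    (hAsmooth : ∀ i k, ContDiff ℝ (⊤ : ℕ∞) (fun p : ℝ × (Fin n → ℝ) => A p.1 p.2 i k))
    {φ : ℝ → (Fin n → ℝ) → (Fin n → ℝ)}
    (hφsmooth : ∀ i, ContDiff ℝ (⊤ : ℕ∞) (fun p : ℝ × (Fin n → ℝ) => φ p.1 p.2 i))
    (hskew : ∀ q, (A 0 q).transpose = -A 0 q)
    (hclosed : ∀ (q : Fin n → ℝ) (i j k : Fin n),
      fderiv ℝ (fun y => A 0 y j k) q (Pi.single i 1)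
        + fderiv ℝ (fun y => A 0 y k i) q (Pi.single j 1)
        + fderiv ℝ (fun y => A 0 y i j) q (Pi.single k 1) = 0)
    (hcurl : ∀ (t : ℝ) (q : Fin n → ℝ) (i j : Fin n),
      fderiv ℝ (fun y => φ t y i) q (Pi.single j 1)
        - fderiv ℝ (fun y => φ t y j) q (Pi.single i 1)
        = deriv (fun s => A s q i j) t) :
    ∃ a : ℝ → (Fin n → ℝ) → Fin n → ℝ,
      (∀ i, ContDiff ℝ (⊤ : ℕ∞) fun p : ℝ × (Fin n → ℝ) => a p.1 p.2 i) ∧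
      (∀ t q i, deriv (fun s => a s q i) t = -φ t q i) ∧
      ∀ t q i j, fderiv ℝ (fun y => a t y j) q (Pi.single i 1) -
        fderiv ℝ (fun y => a t y i) q (Pi.single j 1) = A t q i j := by
  obtain ⟨b, hb, hbcurl⟩ := exists_contDiff_curl_eq (B := A 0)
    (fun i k => (hAsmooth i k).comp (contDiff_prodMk_right 0)) hskew hclosed
  have hφswap (i : Fin n) :
      ContDiff ℝ (⊤ : ℕ∞) (Function.uncurry fun (q : Fin n → ℝ) (s : ℝ) => φ s q i) :=
    (hφsmooth i).comp (contDiff_snd.prodMk contDiff_fst)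
  refine ⟨fun t q i => b q i - ∫ s in (0 : ℝ)..t, φ s q i, fun i => ?_, fun t q i => ?_,
    fun t q i j => ?_⟩
  · refine ((hb i).comp contDiff_snd).sub ?_
    have hscale (p : ℝ × (Fin n → ℝ)) :
        ∫ s in (0 : ℝ)..p.1, φ s p.2 i = p.1 * ∫ s in (0 : ℝ)..1, φ (p.1 * s) p.2 i := by
      simp [intervalIntegral.mul_integral_comp_mul_left (f := fun s => φ s p.2 i)]
    simp only [hscale]
    refine contDiff_fst.mul (contDiff_intervalIntegral_of_contDiff
      (f := fun (p : ℝ × (Fin n → ℝ)) s => φ (p.1 * s) p.2 i) ?_ 0 1)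
    exact (hφsmooth i).comp (((contDiff_fst.comp contDiff_fst).mul contDiff_snd).prodMk
      (contDiff_snd.comp contDiff_fst))
  · rw [deriv_const_sub]
    congr 1
    exact Continuous.deriv_integral _
      ((hφsmooth i).continuous.comp (Continuous.prodMk_left q)) 0 t
  · have hfd (k l : Fin n) :
        fderiv ℝ (fun y => b y k - ∫ s in (0 : ℝ)..t, φ s y k) q (Pi.single l 1) =
          fderiv ℝ (fun y => b y k) q (Pi.single l 1) -
            ∫ s in (0 : ℝ)..t, fderiv ℝ (fun y => φ s y k) q (Pi.single l 1) := by
      rw [fderiv_fun_sub (((hb k).differentiable (by simp)) q)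
        (hasFDerivAt_intervalIntegral_of_contDiff (hφswap k) 0 t q).differentiableAt,
        sub_apply,
        fderiv_intervalIntegral_apply_of_contDiff (hφswap k)]
    have hint (k l : Fin n) : IntervalIntegrable
        (fun s => fderiv ℝ (fun y => φ s y k) q (Pi.single l 1)) MeasureTheory.volume 0 t :=
      Continuous.intervalIntegrable (((contDiff_uncurry_fderiv_left (hφswap k)).continuous.comp
        (Continuous.prodMk_right q)).clm_apply continuous_const) _ _
    have hA : ContDiff ℝ (⊤ : ℕ∞) fun s => A s q i j :=
      (hAsmooth i j).comp (contDiff_prodMk_left q)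
    have hFTC : (∫ s in (0 : ℝ)..t, fderiv ℝ (fun y => φ s y i) q (Pi.single j 1)) -
        ∫ s in (0 : ℝ)..t, fderiv ℝ (fun y => φ s y j) q (Pi.single i 1) =
          A t q i j - A 0 q i j := by
      rw [← intervalIntegral.integral_sub (hint i j) (hint j i)]
      simp only [hcurl]
      exact intervalIntegral.integral_deriv_eq_sub
        (fun s _ => (hA.differentiable (by simp)) s)
        ((hA.continuous_deriv (by simp)).intervalIntegrable _ _)
    rw [hfd, hfd]
    linear_combination hFTC + hbcurl q i j


/-- **Existence of a Lagrangian for `d/dt(M(ẋ)ẋ) = A(t,x)ẋ + φ(t,x)`.**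
If `M(v)` is smooth and symmetric with `Σ_k ∂M_{ik}/∂v_j v_k = Σ_k ∂M_{jk}/∂v_i v_k`,
`A(t,x)` is smooth and antisymmetric with vanishing cyclic `x`-derivative sums, and
`∂φ_i/∂x_j − ∂φ_j/∂x_i = ∂A_{ij}/∂t`, then there is a smooth Lagrangian `L(t,x,v)`
whose Euler–Lagrange expression along every smooth curve equals
`d/dt[M(ẋ)ẋ] − A(t,x)ẋ − φ(t,x)`. -/
theorem exists_lagrangian_of_variational_conditions (n : ℕ) (hn : 1 ≤ n)
    (M : (Fin n → ℝ) → Matrix (Fin n) (Fin n) ℝ)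
    (hMsmooth : ∀ i k, ContDiff ℝ (⊤ : ℕ∞) (fun v => M v i k))
    (hMsymm : ∀ v i k, M v i k = M v k i)
    (A : ℝ → (Fin n → ℝ) → Matrix (Fin n) (Fin n) ℝ)
    (hAsmooth : ∀ i k, ContDiff ℝ (⊤ : ℕ∞) (fun p : ℝ × (Fin n → ℝ) => A p.1 p.2 i k))
    (φ : ℝ → (Fin n → ℝ) → (Fin n → ℝ))
    (hφsmooth : ∀ i, ContDiff ℝ (⊤ : ℕ∞) (fun p : ℝ × (Fin n → ℝ) => φ p.1 p.2 i))
    (hcond1 : ∀ (v : Fin n → ℝ) (i j : Fin n),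
      ∑ k, fderiv ℝ (fun w => M w i k) v (Pi.single j 1) * v k =
      ∑ k, fderiv ℝ (fun w => M w j k) v (Pi.single i 1) * v k)
    (hcond2 : ∀ (t : ℝ) (q : Fin n → ℝ), (A t q).transpose = -A t q)
    (hcond3 : ∀ (t : ℝ) (q : Fin n → ℝ) (i j k : Fin n),
      fderiv ℝ (fun y => A t y j k) q (Pi.single i 1)
        + fderiv ℝ (fun y => A t y k i) q (Pi.single j 1)
        + fderiv ℝ (fun y => A t y i j) q (Pi.single k 1) = 0)
    (hcond4 : ∀ (t : ℝ) (q : Fin n → ℝ) (i j : Fin n),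
      fderiv ℝ (fun y => φ t y i) q (Pi.single j 1)
        - fderiv ℝ (fun y => φ t y j) q (Pi.single i 1)
        = deriv (fun s => A s q i j) t) :
    ∃ L : ℝ → (Fin n → ℝ) → (Fin n → ℝ) → ℝ,
      ContDiff ℝ (⊤ : ℕ∞) (fun p : ℝ × (Fin n → ℝ) × (Fin n → ℝ) => L p.1 p.2.1 p.2.2) ∧
      ∀ x : ℝ → (Fin n → ℝ), ContDiff ℝ (⊤ : ℕ∞) x →
        ∀ (t : ℝ) (i : Fin n),
          deriv (fun s => fderiv ℝ (fun v => L s (x s) v) (deriv x s) (Pi.single i 1)) t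
            - fderiv ℝ (fun q => L t q (deriv x t)) (x t) (Pi.single i 1)
          = deriv (fun s => ∑ k, M (deriv x s) i k * deriv x s k) t
            - (∑ k, A t (x t) i k * deriv x t k) - φ t (x t) i := by
  have hMd (i k : Fin n) : Differentiable ℝ fun v => M v i k :=
    (hMsmooth i k).differentiable (by simp)
  have hp (i : Fin n) : ContDiff ℝ (⊤ : ℕ∞) fun v : Fin n → ℝ => ∑ k, M v i k * v k :=
    ContDiff.sum fun k _ => (hMsmooth i k).mul (contDiff_apply ℝ ℝ k)
  obtain ⟨K, hK, hKgrad⟩ := exists_contDiff_gradient_eq hp fun v i j => by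
    have hpd (i j : Fin n) : fderiv ℝ (fun w : Fin n → ℝ => ∑ k, M w i k * w k) v
        (Pi.single j 1) = M v i j + ∑ k, fderiv ℝ (fun w => M w i k) v (Pi.single j 1) * v k := by
      have h : HasFDerivAt (fun w : Fin n → ℝ => ∑ k, M w i k * w k) _ v :=
        HasFDerivAt.fun_sum fun k _ => (hMd i k v).hasFDerivAt.mul (hasFDerivAt_apply k v)
      rw [h.fderiv]
      simp [Pi.single_apply, Finset.sum_add_distrib, mul_comm]
    rw [hpd, hpd, hMsymm, hcond1]
  obtain ⟨a, ha, hat, hacurl⟩ := exists_contDiff_temporal_gauge_potential hAsmooth hφsmooth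
    (hcond2 0) (hcond3 0) hcond4
  refine ⟨fun t q v => K v + ∑ j, a t q j * v j, ?_, fun x hx t i => ?_⟩
  · refine (hK.comp (contDiff_snd.comp contDiff_snd)).add (ContDiff.sum fun j _ => ?_)
    exact ((ha j).comp (contDiff_fst.prodMk (contDiff_fst.comp contDiff_snd))).mul
      ((contDiff_apply ℝ ℝ j).comp (contDiff_snd.comp contDiff_snd))
  have hfv (s : ℝ) (q v : Fin n → ℝ) :
      fderiv ℝ (fun v => K v + ∑ j, a s q j * v j) v (Pi.single i 1) =
        ∑ k, M v i k * v k + a s q i := by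
    have h : HasFDerivAt (fun v => K v + ∑ j, a s q j * v j) _ v :=
      ((hK.differentiable (by simp)) v).hasFDerivAt.add
        (HasFDerivAt.fun_sum fun j _ => (hasFDerivAt_apply j v).const_mul (a s q j))
    rw [h.fderiv]
    simp [hKgrad, Pi.single_apply]
  have hax (j : Fin n) : Differentiable ℝ fun y => a t y j :=
    ((ha j).comp (contDiff_prodMk_right t)).differentiable (by simp)
  have hfq (q v : Fin n → ℝ) :
      fderiv ℝ (fun q => K v + ∑ j, a t q j * v j) q (Pi.single i 1) =
        ∑ j, fderiv ℝ (fun y => a t y j) q (Pi.single i 1) * v j := by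
    have h : HasFDerivAt (fun q => K v + ∑ j, a t q j * v j) _ q :=
      (HasFDerivAt.fun_sum fun j _ => (hax j q).hasFDerivAt.mul_const (v j)).const_add (K v)
    rw [h.fderiv]
    simp [mul_comm]
  have hx' : ContDiff ℝ (⊤ : ℕ∞) (deriv x) := (contDiff_infty_iff_deriv.1 hx).2
  have hxd : HasDerivAt x (deriv x t) t := ((hx.differentiable (by simp)) t).hasDerivAt
  have hat' : deriv (fun s => a s (x s) i) t =
      -φ t (x t) i + ∑ j, fderiv ℝ (fun y => a t y i) (x t) (Pi.single j 1) * deriv x t j := by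
    have hF : HasFDerivAt (fun p : ℝ × (Fin n → ℝ) => a p.1 p.2 i) _ (t, x t) :=
      (((ha i).differentiable (by simp)) (t, x t)).hasFDerivAt
    have h1 := hF.comp_hasDerivAt t ((hasDerivAt_id t).prodMk (hasDerivAt_const t (x t)))
    have h2 := hF.comp (x t) (hasFDerivAt_prodMk_right t (x t))
    have h := hF.comp_hasDerivAt t ((hasDerivAt_id t).prodMk hxd)
    have e1 := (hat t (x t) i).symm.trans h1.deriv
    have e2 : fderiv ℝ (fun y => a t y i) (x t) = _ := h2.fderiv
    refine h.deriv.trans ?_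
    rw [e1, ← Finset.sum_congr rfl fun j _ => mul_comm _ _,
      ← (fderiv ℝ (fun y => a t y i) (x t)).apply_eq_sum_single, e2,
      ContinuousLinearMap.comp_apply, ContinuousLinearMap.inr_apply, ← map_add]
    simp
  have hpd : DifferentiableAt ℝ (fun s => ∑ k, M (deriv x s) i k * deriv x s k) t :=
    (((hp i).comp hx').differentiable (by simp)) t
  have had : DifferentiableAt ℝ (fun s => a s (x s) i) t :=
    (((ha i).comp (contDiff_id.prodMk hx)).differentiable (by simp)) t
  simp only [hfv, hfq]
  rw [deriv_fun_add hpd had, hat']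
  simp only [← hacurl, sub_mul, Finset.sum_sub_distrib]
  ring
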